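/- If λ is a measurable cardinal then the diamond principle ◊_λ holds. -/

import Mathlib

noncomputable section

open Cardinal Set

namespace WDP

/-- `S` is an unbounded subset of the ordinals below `o`: `sup S = o`. -/
def IsUnboundedIn (o : Ordinal) (S : Set Ordinal) : Prop :=
  S ⊆ Set.Iio o ∧ sSup S = o

/-- `C` is a club (closed unbounded) subset of the ordinals below `o`. -/
def IsClubIn (o : Ordinal) (C : Set Ordinal) : Prop :=
  IsUnboundedIn o C ∧ ∀ s ⊆ C, s.Nonempty → sSup s < o → sSup s ∈ C

/-- `S` is a stationary subset of the ordinals below `o`. -/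
def IsStationaryIn (o : Ordinal) (S : Set Ordinal) : Prop :=
  S ⊆ Set.Iio o ∧ ∀ C, IsClubIn o C → (S ∩ C).Nonempty

/-- A coloring `c : 2^{<o} → 2`. -/
def Coloring (o : Ordinal) :=
  (α : Set.Iio o) → (Set.Iio α.1 → Bool) → Bool

/-- The restriction `f ↾ α` of `f : o → 2` to `α < o`. -/
def restr {o : Ordinal} (f : Set.Iio o → Bool) (α : Set.Iio o) : Set.Iio α.1 → Bool :=
  fun β => f ⟨β.1, Set.mem_Iio.mpr ((Set.mem_Iio.mp β.2).trans (Set.mem_Iio.mp α.2))⟩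

/-- The set `{α < o : c (f ↾ α) = g α}`. -/
def guessSet (o : Ordinal) (c : Coloring o) (f g : Set.Iio o → Bool) : Set Ordinal :=
  {β | ∃ h : β < o, c ⟨β, h⟩ (restr f ⟨β, h⟩) = g ⟨β, h⟩}

/-- The weak diamond `Φ_S` on a set `S` of ordinals below `o`. -/
def WeakDiamondOn (o : Ordinal) (S : Set Ordinal) : Prop :=
  ∀ c : Coloring o, ∃ g : Set.Iio o → Bool, ∀ f : Set.Iio o → Bool,
    IsStationaryIn o (guessSet o c f g ∩ S)

/-- The weak diamond `Φ_o`. -/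
def WeakDiamond (o : Ordinal) : Prop :=
  ∀ c : Coloring o, ∃ g : Set.Iio o → Bool, ∀ f : Set.Iio o → Bool,
    IsStationaryIn o (guessSet o c f g)

/-- The very weak diamond `Ψ_o`. -/
def VeryWeakDiamond (o : Ordinal) : Prop :=
  ∀ c : Coloring o, ∃ g : Set.Iio o → Bool, ∀ f : Set.Iio o → Bool,
    IsUnboundedIn o (guessSet o c f g)

/-- The diamond principle `◊_o`. -/
def Diamond (o : Ordinal) : Prop :=
  ∃ A : Set.Iio o → Set Ordinal,
    (∀ α : Set.Iio o, A α ⊆ Set.Iio α.1) ∧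
    ∀ X : Set Ordinal, X ⊆ Set.Iio o →
      IsStationaryIn o {β | ∃ h : β < o, A ⟨β, h⟩ = X ∩ Set.Iio β}

/-- `κ` is a measurable cardinal: it is uncountable and carries a κ-complete
nonprincipal ultrafilter. -/
def IsMeasurableCard (κ : Cardinal) : Prop :=
  Cardinal.aleph0 < κ ∧
  ∃ U : Ultrafilter (Set.Iio κ.ord),
    (∀ α : Set.Iio κ.ord, ({α}ᶜ : Set (Set.Iio κ.ord)) ∈ U) ∧
    ∀ (τ : Ordinal), τ < κ.ord → ∀ s : Set.Iio τ → Set (Set.Iio κ.ord),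
      (∀ i, s i ∈ U) → (⋂ i, s i) ∈ U

/-- The parametrized weak diamond `θ-Φ_κ`. -/
def ParamWeakDiamond (κ : Cardinal) (θ : Cardinal) : Prop :=
  ∀ c : Coloring κ.ord, ∃ g : Set.Iio θ.ord → (Set.Iio κ.ord → Bool),
    ∀ f : Set.Iio κ.ord → Bool, ∃ τ, IsStationaryIn κ.ord (guessSet κ.ord c f (g τ))

universe u

/-- A normal ultrafilter on the ordinals below `o`, viewed as an ultrafilter on all ordinals:
it concentrates on `o`, contains no bounded set, and regressive functions are constant on a
set of the ultrafilter. -/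
structure IsNormalOn (V : Ultrafilter Ordinal.{u}) (o : Ordinal.{u}) : Prop where
  lt_top : ∀ᶠ α in V, α < o
  gt : ∀ ξ < o, ∀ᶠ α in V, ξ < α
  regressive : ∀ g : Ordinal.{u} → Ordinal.{u}, (∀ᶠ α in V, g α < α) →
    ∃ ξ < o, ∀ᶠ α in V, g α = ξ

namespace IsNormalOn

variable {V : Ultrafilter Ordinal.{u}} {o : Ordinal.{u}}

/-- Closure under diagonal intersections. -/
theorem diagonal (hV : IsNormalOn V o) {P : Ordinal.{u} → Ordinal.{u} → Prop}
    (hP : ∀ ξ < o, ∀ᶠ α in V, P ξ α) : ∀ᶠ α in V, ∀ ξ < α, P ξ α := by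
  classical
  by_contra hcon
  rw [← Ultrafilter.eventually_not] at hcon
  let g : Ordinal.{u} → Ordinal.{u} := fun α =>
    if h : ∃ ξ < α, ¬ P ξ α then h.choose else 0
  have hg : ∀ᶠ α in V, g α < α ∧ ¬ P (g α) α := by
    filter_upwards [hcon] with α hα
    push Not at hα
    simp only [g, dif_pos hα]
    exact hα.choose_spec
  obtain ⟨ξ, hξ, hgξ⟩ := hV.regressive g (hg.mono fun _ h => h.1)
  obtain ⟨α, hα⟩ := ((hg.and hgξ).and (hP ξ hξ)).exists
  exact hα.1.1.2 (hα.1.2 ▸ hα.2)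

/-- A family of sets `K α ⊆ α` coheres on a set of the ultrafilter. -/
theorem exists_coherent (hV : IsNormalOn V o) {K : Ordinal.{u} → Set Ordinal.{u}}
    (hK : ∀ᶠ α in V, K α ⊆ Iio α) :
    ∃ D ⊆ Iio o, ∀ᶠ α in V, K α = D ∩ Iio α := by
  refine ⟨{ξ | ξ < o ∧ ∀ᶠ α in V, ξ ∈ K α}, fun ξ h => h.1, ?_⟩
  have hdiag : ∀ᶠ α in V, ∀ ξ < α, (ξ ∈ K α ↔ ∀ᶠ α in V, ξ ∈ K α) := by
    refine hV.diagonal fun ξ _ => ?_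
    by_cases h : ∀ᶠ α in V, ξ ∈ K α
    · exact h.mono fun α hα => iff_of_true hα h
    · exact (Ultrafilter.eventually_not.2 h).mono fun α hα => iff_of_false hα h
  filter_upwards [hK, hdiag, hV.lt_top] with α hα hd hlt
  ext ξ
  constructor
  · intro h
    exact ⟨⟨(hα h).trans hlt, (hd ξ (hα h)).1 h⟩, hα h⟩
  · rintro ⟨⟨-, h⟩, hξ⟩
    exact (hd ξ hξ).2 h

/-- Almost every ordinal is a limit point of a given club. -/
theorem eventually_sSup_inter_eq (hV : IsNormalOn V o) {C : Set Ordinal.{u}}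
    (hC : IsUnboundedIn o C) : ∀ᶠ α in V, sSup (C ∩ Iio α) = α := by
  by_contra hcon
  rw [← Ultrafilter.eventually_not] at hcon
  obtain ⟨ξ, hξ, hg⟩ := hV.regressive (fun α => sSup (C ∩ Iio α))
    (hcon.mono fun α hα => lt_of_le_of_ne (csSup_le' fun _ h => h.2.le) hα)
  obtain ⟨δ, hδC, hδ⟩ := exists_lt_of_lt_csSup' (hC.2.symm ▸ hξ)
  obtain ⟨α, hα, hδα⟩ := (hg.and (hV.gt δ (hC.1 hδC))).exists
  have : δ ≤ sSup (C ∩ Iio α) := le_csSup ⟨α, fun _ h => h.2.le⟩ ⟨hδC, hδα⟩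
  exact (hα ▸ this).not_gt hδ

theorem eventually_isClubIn_inter (hV : IsNormalOn V o) {C : Set Ordinal.{u}}
    (hC : IsClubIn o C) : ∀ᶠ α in V, IsClubIn α (C ∩ Iio α) := by
  filter_upwards [hV.eventually_sSup_inter_eq hC.1, hV.lt_top] with α hα hlt
  exact ⟨⟨inter_subset_right, hα⟩, fun s hs hne hlts =>
    ⟨hC.2 s (fun _ h => (hs h).1) hne (hlts.trans hlt), hlts⟩⟩

theorem eventually_mem_of_isClubIn (hV : IsNormalOn V o) (ho : 0 < o) {C : Set Ordinal.{u}}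
    (hC : IsClubIn o C) : ∀ᶠ α in V, α ∈ C := by
  filter_upwards [hV.eventually_sSup_inter_eq hC.1, hV.lt_top, hV.gt 0 ho] with α hα hlt hpos
  obtain ⟨δ, hδ, -⟩ := exists_lt_of_lt_csSup' (hα.symm ▸ hpos)
  have := hC.2 (C ∩ Iio α) inter_subset_left ⟨δ, hδ⟩ (hα.symm ▸ hlt)
  rwa [hα] at this

/-- A set almost all of whose initial segments are club is itself club. -/
theorem isClubIn_of_eventually (hV : IsNormalOn V o) {D : Set Ordinal.{u}} (hDo : D ⊆ Iio o)
    (hD : ∀ᶠ α in V, IsClubIn α (D ∩ Iio α)) : IsClubIn o D := by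
  refine ⟨⟨hDo, le_antisymm (csSup_le' fun _ h => (hDo h).le) ?_⟩, ?_⟩
  · refine le_of_forall_lt fun ξ hξ => ?_
    obtain ⟨α, hα, hξα⟩ := (hD.and (hV.gt ξ hξ)).exists
    obtain ⟨δ, hδ, hξδ⟩ := exists_lt_of_lt_csSup' (hα.1.2.symm ▸ hξα)
    exact hξδ.trans_le (le_csSup ⟨o, fun _ h => (hDo h).le⟩ hδ.1)
  · intro s hs hne hlt
    obtain ⟨α, hα, hsα⟩ := (hD.and (hV.gt _ hlt)).exists
    have hbdd : BddAbove s := ⟨o, fun _ h => (hDo (hs h)).le⟩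
    exact (hα.2 s (fun x hx => ⟨hs hx, (le_csSup hbdd hx).trans_lt hsα⟩) hne hsα).1

end IsNormalOn

/-- `X ⊆ α` is not guessed by the sequence `A` of length `α` on some club of `α`. -/
def IsUnguessed (α : Ordinal.{u}) (A : ∀ β < α, Set Ordinal.{u}) (X : Set Ordinal.{u}) : Prop :=
  X ⊆ Iio α ∧ ∃ C, IsClubIn α C ∧ ∀ β (h : β < α), β ∈ C → A β h ≠ X ∩ Iio β

open Classical in
/-- The sequence which at each `α` picks a subset of `α` not guessed so far, if there is one. -/
def guess : Ordinal.{u} → Set Ordinal.{u} :=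
  Ordinal.lt_wf.fix fun α A => if h : ∃ X, IsUnguessed α A X then h.choose else ∅

open Classical in
theorem guess_eq_dite (α : Ordinal.{u}) :
    guess α = if h : ∃ X, IsUnguessed α (fun β _ => guess β) X then h.choose else ∅ :=
  Ordinal.lt_wf.fix_eq _ α

theorem isUnguessed_guess {α : Ordinal.{u}}
    (h : ∃ X, IsUnguessed α (fun β _ => guess β) X) :
    IsUnguessed α (fun β _ => guess β) (guess α) := by
  rw [guess_eq_dite α, dif_pos h]
  exact h.choose_spec

theorem guess_subset (α : Ordinal.{u}) : guess α ⊆ Iio α := by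
  by_cases h : ∃ X, IsUnguessed α (fun β _ => guess β) X
  · exact (isUnguessed_guess h).1
  · rw [guess_eq_dite α, dif_neg h]
    exact empty_subset _

theorem IsNormalOn.diamond {V : Ultrafilter Ordinal.{u}} {o : Ordinal.{u}}
    (hV : IsNormalOn V o) (ho : 0 < o) : Diamond o := by
  refine ⟨fun α => guess α, fun α => guess_subset α, fun X _ => ⟨fun β h => h.1, fun C hC => ?_⟩⟩
  by_contra hcon
  have hXC : ∀ β ∈ C, guess β ≠ X ∩ Iio β := fun β hβ h =>
    hcon ⟨β, ⟨hC.1.1 hβ, h⟩, hβ⟩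
  have hbad : ∀ᶠ α in V, ∃ K, IsClubIn α K ∧ ∀ β ∈ K, guess β ≠ guess α ∩ Iio β := by
    filter_upwards [hV.eventually_isClubIn_inter hC] with α hα
    obtain ⟨-, K, hK, hKα⟩ := isUnguessed_guess (α := α) ⟨X ∩ Iio α, inter_subset_right,
      C ∩ Iio α, hα, fun β h hβ => by
        rw [inter_assoc, inter_eq_right.2 (Iio_subset_Iio h.le)]
        exact hXC β hβ.1⟩
    exact ⟨K, hK, fun β hβ => hKα β (hK.1.1 hβ) hβ⟩
  obtain ⟨K, hK⟩ := hbad.choice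
  obtain ⟨D, hDo, hD⟩ := hV.exists_coherent (hK.mono fun _ h => h.1.1.1)
  obtain ⟨E, -, hE⟩ := hV.exists_coherent (Filter.Eventually.of_forall guess_subset)
  have hDclub : IsClubIn o D := hV.isClubIn_of_eventually hDo <| by
    filter_upwards [hK, hD] with α hα hDα using hDα ▸ hα.1
  obtain ⟨β, hβE, hβD⟩ := (hE.and (hV.eventually_mem_of_isClubIn ho hDclub)).exists
  obtain ⟨α, ⟨⟨hKα, hDα⟩, hEα⟩, hβα⟩ := (((hK.and hD).and hE).and (hV.gt β (hDo hβD))).exists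
  refine hKα.2 β (hDα ▸ ⟨hβD, hβα⟩) ?_
  rw [hEα, inter_assoc, inter_eq_right.2 (Iio_subset_Iio hβα.le), hβE]

/-- A countably complete ultrafilter has a well-founded ultrapower of the ordinals. -/
theorem wellFounded_eventually_lt {ι : Type*} (U : Ultrafilter ι)
    (hU : ∀ s : ℕ → Set ι, (∀ n, s n ∈ U) → (⋂ n, s n) ∈ U) :
    WellFounded fun g h : ι → Ordinal.{u} => ∀ᶠ i in U, g i < h i := by
  rw [wellFounded_iff_isEmpty_descending_chain]
  refine ⟨fun ⟨f, hf⟩ => ?_⟩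
  obtain ⟨i, hi⟩ := U.nonempty_of_mem (hU (fun n => {i | f (n + 1) i < f n i}) hf)
  exact (wellFounded_iff_isEmpty_descending_chain.1 Ordinal.lt_wf.{u}).false
    ⟨fun n => f n i, fun n => mem_iInter.1 hi n⟩

/-- A measurable cardinal carries a normal ultrafilter. -/
theorem IsMeasurableCard.exists_isNormalOn {κ : Cardinal.{u}} (hκ : IsMeasurableCard κ) :
    ∃ V : Ultrafilter Ordinal.{u}, IsNormalOn V κ.ord := by
  obtain ⟨hω, U, hne, hU⟩ := hκ
  have hωo : Ordinal.omega0 < κ.ord := by rwa [← Cardinal.ord_aleph0, Cardinal.ord_lt_ord]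
  have hsucc : ∀ ξ < κ.ord, Order.succ ξ < κ.ord := fun ξ hξ =>
    (Cardinal.isSuccLimit_ord hω.le).succ_lt hξ
  have hall : ∀ ξ < κ.ord, ∀ P : Ordinal.{u} → Iio κ.ord → Prop,
      (∀ η ≤ ξ, ∀ᶠ i in U, P η i) → ∀ᶠ i in U, ∀ η ≤ ξ, P η i := by
    intro ξ hξ P hP
    refine Filter.mem_of_superset (hU _ (hsucc ξ hξ) (fun η => {i | P η i})
      fun η => hP η (Order.lt_succ_iff.1 η.2)) fun i hi η hη => ?_
    exact mem_iInter.1 hi ⟨η, Order.lt_succ_iff.2 hη⟩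
  have hnat : ∀ s : ℕ → Set (Iio κ.ord), (∀ n, s n ∈ U) → (⋂ n, s n) ∈ U := by
    intro s hs
    have h := hall _ hωo (fun η i => ∀ n : ℕ, (n : Ordinal.{u}) = η → i ∈ s n) fun η _ => by
      by_cases hη : ∃ n : ℕ, (n : Ordinal.{u}) = η
      · obtain ⟨n, rfl⟩ := hη
        filter_upwards [hs n] with i hi m hm
        rwa [Nat.cast_inj.1 hm]
      · exact Filter.Eventually.of_forall fun i n hn => (hη ⟨n, hn⟩).elim
    filter_upwards [h] with i hi
    exact mem_iInter.2 fun n => hi n (Ordinal.natCast_lt_omega0 n).le n rfl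
  let S : Set (Iio κ.ord → Ordinal.{u}) := {g | ∀ ξ < κ.ord, ∀ᶠ i in U, ξ < g i}
  have hid : (fun i : Iio κ.ord => i.1) ∈ S := fun ξ hξ => by
    have := hall ξ hξ (fun η i => i.1 ≠ η) fun η hη =>
      Filter.mem_of_superset (hne ⟨η, hη.trans_lt hξ⟩) fun i hi h => hi (Subtype.ext h)
    filter_upwards [this] with i hi
    exact lt_of_not_ge fun h => hi _ h rfl
  have hwf := wellFounded_eventually_lt.{u} U hnat
  obtain ⟨f, hfS, hmin⟩ := hwf.has_min S ⟨_, hid⟩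
  refine ⟨U.map f, ?_, hfS, ?_⟩
  · have := Ultrafilter.eventually_not.2 (hmin _ hid)
    show ∀ᶠ i in U, f i < κ.ord
    filter_upwards [this] with i hi
    exact (not_lt.1 hi).trans_lt i.2
  · intro g hg
    have hgS : g ∘ f ∉ S := fun h => hmin _ h hg
    simp only [S, mem_ofPred_eq, not_forall] at hgS
    obtain ⟨ξ, hξ, hgξ⟩ := hgS
    by_contra hcon
    have := hall ξ hξ (fun η i => g (f i) ≠ η) fun η hη =>
      Ultrafilter.eventually_not.2 fun h => hcon ⟨η, hη.trans_lt hξ, h⟩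
    refine hgξ ?_
    filter_upwards [this] with i hi
    exact lt_of_not_ge fun h => hi _ h rfl

theorem diamond_of_measurable (lam : Cardinal)
    (hmeas : IsMeasurableCard lam) : Diamond lam.ord := by
  obtain ⟨V, hV⟩ := hmeas.exists_isNormalOn
  exact hV.diamond (Cardinal.ord_pos.2 (Cardinal.aleph0_pos.trans hmeas.1))

end WDP
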